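/- Let S = {s_1, …, s_n} be a finite set, 𝒞 = {C_1, …, C_m} a family of subsets of S, k a natural number, and N a real number with N > n. Consider the reduction digraph G with vertex set {r} ∪ {C_1, …, C_m} ∪ {s_1, …, s_n}, an edge from r to each C_i of weight N, and an edge from C_i to s_j of weight 1 whenever s_j ∈ C_i. If G contains a directed subtree rooted at r (all edges oriented away from r) whose total edge weight is at most kN + n and which has at least k + n + 1 vertices, then there exists a subfamily 𝒞' ⊆ 𝒞 with |𝒞'| ≤ k such that every element of S belongs to some member of 𝒞'; moreover one such cover is 𝒞' = V(T) ∩ 𝒞, the set of set-vertices used by the subtree T. -/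

import Mathlib

/-- Vertex type of the reduction digraph: `none` is the root `r`,
`some (Sum.inl C)` is the set-vertex for a set `C`, and
`some (Sum.inr s)` is the element-vertex for an element `s`. -/
abbrev RedVertex (α : Type*) := Option (Finset α ⊕ α)

/-- Edge relation of the reduction digraph associated to the family `𝒞`:
an edge from the root to each set-vertex `C ∈ 𝒞`, and an edge from a
set-vertex `C ∈ 𝒞` to an element-vertex `s` whenever `s ∈ C`. -/
def redEdge {α : Type*} (𝒞 : Finset (Finset α)) : RedVertex α → RedVertex α → Prop
  | none, some (Sum.inl C) => C ∈ 𝒞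
  | some (Sum.inl C), some (Sum.inr s) => C ∈ 𝒞 ∧ s ∈ C
  | _, _ => False

/-- Edge weights of the reduction digraph: weight `N` on edges from the root to a
set-vertex, weight `1` on edges from a set-vertex to an element-vertex. -/
def redWeight {α : Type*} (N : ℝ) : RedVertex α → RedVertex α → ℝ
  | none, some (Sum.inl _) => N
  | some (Sum.inl _), some (Sum.inr _) => 1
  | _, _ => 0

/-- A directed subtree of the digraph with edge relation `E`, rooted at `r`,
with all edges oriented away from `r`: a finite vertex set containing `r`
together with a parent assignment for the non-root vertices, such that every
parent edge is an edge of the digraph and every vertex is connected to the root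
(witnessed by a depth function strictly decreasing towards the root). -/
structure DirectedSubtree {V : Type*} (E : V → V → Prop) (r : V) where
  verts : Finset V
  parent : V → V
  depth : V → ℕ
  root_mem : r ∈ verts
  parent_mem : ∀ v ∈ verts, v ≠ r → parent v ∈ verts
  parent_edge : ∀ v ∈ verts, v ≠ r → E (parent v) v
  depth_lt : ∀ v ∈ verts, v ≠ r → depth (parent v) < depth v

/-- The cost of a rooted subtree: the sum of the weights of its edges,
one edge `(parent v, v)` for every non-root vertex `v`. -/
def treeCost {V : Type*} [DecidableEq V] {E : V → V → Prop} {r : V}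
    (c : V → V → ℝ) (T : DirectedSubtree E r) : ℝ :=
  ∑ v ∈ T.verts.erase r, c (T.parent v) v

section

variable {α : Type*} {𝒞 : Finset (Finset α)}

theorem DirectedSubtree.parent_setVertex (T : DirectedSubtree (redEdge 𝒞) none) {C : Finset α}
    (h : some (Sum.inl C) ∈ T.verts) : T.parent (some (Sum.inl C)) = none ∧ C ∈ 𝒞 := by
  have he := T.parent_edge _ h (by simp)
  rcases hp : T.parent (some (Sum.inl C)) with _ | D | s <;> rw [hp] at he <;>
    simp_all [redEdge]

theorem DirectedSubtree.parent_elementVertex (T : DirectedSubtree (redEdge 𝒞) none) {s : α}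
    (h : some (Sum.inr s) ∈ T.verts) :
    ∃ C, T.parent (some (Sum.inr s)) = some (Sum.inl C) ∧ some (Sum.inl C) ∈ T.verts ∧
      C ∈ 𝒞 ∧ s ∈ C := by
  have he := T.parent_edge _ h (by simp)
  have hm := T.parent_mem _ h (by simp)
  rcases hp : T.parent (some (Sum.inr s)) with _ | D | t <;> rw [hp] at he hm <;>
    simp_all [redEdge]

variable [DecidableEq α]

theorem DirectedSubtree.verts_erase_root (T : DirectedSubtree (redEdge 𝒞) none)
    {S : Finset α} (hsub : ∀ C ∈ 𝒞, C ⊆ S) :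
    T.verts.erase none =
      ((𝒞.filter fun C => (some (Sum.inl C) : RedVertex α) ∈ T.verts).disjSum
        (S.filter fun s => (some (Sum.inr s) : RedVertex α) ∈ T.verts)).map
          Function.Embedding.some := by
  ext v
  rcases v with _ | C | s
  · simp
  · simpa using fun h => (T.parent_setVertex h).2
  · simp only [Finset.mem_erase, Finset.mem_map, Function.Embedding.some_apply, Option.some.injEq,
      exists_eq_right, Finset.inr_mem_disjSum, Finset.mem_filter, ne_eq, reduceCtorEq,
      not_false_eq_true, true_and, iff_and_self]
    intro h
    obtain ⟨C, -, -, hC, hs⟩ := T.parent_elementVertex h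
    exact hsub C hC hs

theorem treeCost_redWeight (T : DirectedSubtree (redEdge 𝒞) none)
    {S : Finset α} (hsub : ∀ C ∈ 𝒞, C ⊆ S) (N : ℝ) :
    treeCost (redWeight N) T =
      (𝒞.filter fun C => (some (Sum.inl C) : RedVertex α) ∈ T.verts).card * N +
        (S.filter fun s => (some (Sum.inr s) : RedVertex α) ∈ T.verts).card := by
  rw [treeCost, T.verts_erase_root hsub, Finset.sum_map, Finset.sum_disjSum]
  congr 1
  · rw [← nsmul_eq_mul]
    refine Finset.sum_eq_card_nsmul fun C hC => ?_
    simp [(T.parent_setVertex (Finset.mem_filter.1 hC).2).1, redWeight]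
  · rw [← nsmul_one]
    refine Finset.sum_eq_card_nsmul fun s hs => ?_
    obtain ⟨C, hC, -⟩ := T.parent_elementVertex (Finset.mem_filter.1 hs).2
    simp [hC, redWeight]

end

/-- If the reduction digraph contains a directed subtree `T` rooted at `r` of total
edge weight at most `k·N + n` with at least `k + n + 1` vertices (where `n = |S|`),
then the set-cover instance `(S, 𝒞)` admits a cover of size at most `k`; moreover,
one such cover is `𝒞' = V(T) ∩ 𝒞`, the family of set-vertices used by `T`. -/
theorem tree_to_setCover {α : Type*} [DecidableEq α]
    (S : Finset α) (𝒞 : Finset (Finset α)) (hsub : ∀ C ∈ 𝒞, C ⊆ S)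
    (k : ℕ) (N : ℝ) (hN : (S.card : ℝ) < N)
    (T : DirectedSubtree (redEdge 𝒞) (none : RedVertex α))
    (hcost : treeCost (redWeight N) T ≤ k * N + S.card)
    (hsize : k + S.card + 1 ≤ T.verts.card) :
    (∃ 𝒞' ⊆ 𝒞, 𝒞'.card ≤ k ∧ ∀ s ∈ S, ∃ C ∈ 𝒞', s ∈ C) ∧
    ((𝒞.filter fun C => (some (Sum.inl C) : RedVertex α) ∈ T.verts) ⊆ 𝒞 ∧
      (𝒞.filter fun C => (some (Sum.inl C) : RedVertex α) ∈ T.verts).card ≤ k ∧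
      ∀ s ∈ S, ∃ C ∈ (𝒞.filter fun C => (some (Sum.inl C) : RedVertex α) ∈ T.verts),
        s ∈ C) := by
  rw [treeCost_redWeight T hsub] at hcost
  have hcard := congrArg Finset.card (T.verts_erase_root hsub)
  rw [Finset.card_erase_of_mem T.root_mem, Finset.card_map, Finset.card_disjSum] at hcard
  have hk : (𝒞.filter fun C => (some (Sum.inl C) : RedVertex α) ∈ T.verts).card ≤ k := by
    by_contra! h
    have h' : (k : ℝ) + 1 ≤
        (𝒞.filter fun C => (some (Sum.inl C) : RedVertex α) ∈ T.verts).card := by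
      exact_mod_cast h
    have hNpos : 0 ≤ N := (Nat.cast_nonneg _).trans hN.le
    have hmul := mul_le_mul_of_nonneg_right h' hNpos
    have hB : (0 : ℝ) ≤ (S.filter fun s => (some (Sum.inr s) : RedVertex α) ∈ T.verts).card :=
      Nat.cast_nonneg _
    linarith
  have hS : (S.filter fun s => (some (Sum.inr s) : RedVertex α) ∈ T.verts) = S :=
    Finset.eq_of_subset_of_card_le (Finset.filter_subset _ _) (by omega)
  have hcover : ∀ s ∈ S,
      ∃ C ∈ (𝒞.filter fun C => (some (Sum.inl C) : RedVertex α) ∈ T.verts), s ∈ C := by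
    intro s hs
    obtain ⟨C, -, hCT, hC, hsC⟩ := T.parent_elementVertex (Finset.filter_eq_self.1 hS s hs)
    exact ⟨C, Finset.mem_filter.2 ⟨hC, hCT⟩, hsC⟩
  exact ⟨⟨_, Finset.filter_subset _ _, hk, hcover⟩, Finset.filter_subset _ _, hk, hcover⟩
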